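/- arXiv:1909.13257 — 2 statements merged into one kernel-verified Lean document; each statement's English description precedes it below -/
import Mathlib

section
/- Let z ∈ ℂ and suppose there exists μ > 0 such that |z| ≤ μ/Ψ(μ). Then |z|·𝓑(|z|) ≤ μ (in particular the tree sum 𝓑(|z|) is finite), and for every measurable Λ ⊆ ℝ^d of finite Lebesgue measure |Λ|, |Σ_{n≥1} (z^n/n!) ∫_{Λ^n} ω^T_n(x_1,…,x_n) dx_1⋯dx_n| ≤ |Λ|·|z|·𝓑(|z|) ≤ |Λ|·μ. -/
open MeasureTheory ENNReal
open scoped Classical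

noncomputable section

/-- Pair weight `w(x,y) = exp(-β φ(x-y))`, with `exp(-(+∞)) = 0`. -/
def pairW {d : ℕ} (β : ℝ) (φ : (Fin d → ℝ) → ℝ≥0∞) (x y : Fin d → ℝ) : ℝ :=
  if φ (x - y) = ∞ then 0 else Real.exp (-(β * (φ (x - y)).toReal))

/-- Truncated weight `ω^T_n`: sum over connected graphs on `{1,…,n}`. -/
def omegaT {S : Type*} (w : S → S → ℝ) (n : ℕ) (x : Fin n → S) : ℝ :=
  ∑ G : SimpleGraph (Fin n),
    if G.Connected then
      ∏ p ∈ Finset.univ.filter (fun p : Fin n × Fin n => p.1 < p.2 ∧ G.Adj p.1 p.2),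
        (w (x p.1) (x p.2) - 1)
    else 0

/-- `φ_n(x; x_1,…,x_n) = Π_i (1 - w(x,x_i)) Π_{i<j} w(x_i,x_j)`. -/
def phiVertex {S : Type*} (w : S → S → ℝ) (n : ℕ) (x : S) (y : Fin n → S) : ℝ :=
  (∏ i, (1 - w x (y i))) *
    ∏ p ∈ Finset.univ.filter (fun p : Fin n × Fin n => p.1 < p.2), w (y p.1) (y p.2)

/-- `g(n) = ∫_{ℝ^{dn}} φ_n(0; x_1,…,x_n) dx`. -/
def gCoef {d : ℕ} (β : ℝ) (φ : (Fin d → ℝ) → ℝ≥0∞) (n : ℕ) : ℝ≥0∞ :=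
  ∫⁻ y : Fin n → Fin d → ℝ, ENNReal.ofReal (phiVertex (pairW β φ) n 0 y)

/-- The vertex sum `Ψ(t) = 1 + Σ_{n≥1} g(n) t^n/n!` (extended to `t ∈ [0,∞]`). -/
def vertexSum {d : ℕ} (β : ℝ) (φ : (Fin d → ℝ) → ℝ≥0∞) (t : ℝ≥0∞) : ℝ≥0∞ :=
  1 + ∑' n : ℕ, gCoef β φ (n + 1) * t ^ (n + 1) / ((n + 1).factorial : ℝ≥0∞)

/-- The children of vertex `i` in a tree on `{0,…,n}` rooted at `0`. -/
def childrenF {n : ℕ} (τ : SimpleGraph (Fin (n + 1))) (i : Fin (n + 1)) :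
    Finset (Fin (n + 1)) :=
  Finset.univ.filter (fun j => τ.Adj i j ∧ τ.dist 0 j = τ.dist 0 i + 1)

/-- `φ_{|t|}(x; (y_j)_{j∈t})`, the vertex weight of `x` with the family of children `t`. -/
def phiFinset {S : Type*} {n : ℕ} (w : S → S → ℝ) (x : S)
    (t : Finset (Fin n)) (y : Fin n → S) : ℝ :=
  (∏ j ∈ t, (1 - w x (y j))) *
    ∏ p ∈ (t ×ˢ t).filter (fun p => p.1 < p.2), w (y p.1) (y p.2)

/-- `B_n(x_0; x_1,…,x_n)`: sum over trees rooted at `0` of the product of vertex weights. -/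
def treeB {S : Type*} (w : S → S → ℝ) (n : ℕ) (x : Fin (n + 1) → S) : ℝ :=
  ∑ τ : SimpleGraph (Fin (n + 1)),
    if τ.IsTree then ∏ i : Fin (n + 1), phiFinset w (x i) (childrenF τ i) x else 0

/-- The tree sum `𝓑(r) = 1 + Σ_{n≥1} (r^n/n!) ∫ B_n(0;x_1,…,x_n) dx`. -/
def treeSum {d : ℕ} (β : ℝ) (φ : (Fin d → ℝ) → ℝ≥0∞) (r : ℝ) : ℝ≥0∞ :=
  1 + ∑' n : ℕ, ENNReal.ofReal (r ^ (n + 1) / (n + 1).factorial) *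
    ∫⁻ y : Fin (n + 1) → Fin d → ℝ,
      ENNReal.ofReal (treeB (pairW β φ) (n + 1) (Fin.cons 0 y))

theorem mem_childrenF {n : ℕ} (τ : SimpleGraph (Fin (n + 1))) (i j : Fin (n + 1)) :
    j ∈ childrenF τ i ↔ τ.Adj i j ∧ τ.dist 0 j = τ.dist 0 i + 1 := by
  simp [childrenF]

theorem SimpleGraph.Connected.exists_adj_dist_succ {V : Type*} {G : SimpleGraph V}
    (hG : G.Connected) {r j : V} (hj : j ≠ r) : ∃ i, G.Adj i j ∧ G.dist r j = G.dist r i + 1 := by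
  obtain ⟨p, hp⟩ := hG.exists_walk_length_eq_dist r j
  have hnil : ¬ p.Nil := fun h => hj h.eq.symm
  refine ⟨p.penultimate, p.adj_penultimate hnil, ?_⟩
  have h1 := SimpleGraph.dist_le p.dropLast
  have h2 : p.dropLast.length + 1 = p.length := SimpleGraph.Walk.length_dropLast_add_one hnil
  have h3 := hG.dist_triangle (u := r) (v := p.penultimate) (w := j)
  have h4 := SimpleGraph.dist_eq_one_iff_adj.mpr (p.adj_penultimate hnil)
  omega

theorem SimpleGraph.IsTree.eq_of_adj_of_dist_succ {V : Type*} {G : SimpleGraph V} (hG : G.IsTree)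
    {r i k j : V} (hi : G.Adj i j) (hid : G.dist r j = G.dist r i + 1)
    (hk : G.Adj k j) (hkd : G.dist r j = G.dist r k + 1) : i = k := by
  obtain ⟨p, hp⟩ := hG.connected.exists_walk_length_eq_dist r i
  obtain ⟨q, hq⟩ := hG.connected.exists_walk_length_eq_dist r k
  have hp' : (p.concat hi).IsPath :=
    SimpleGraph.Walk.isPath_of_length_eq_dist _ (by rw [SimpleGraph.Walk.length_concat]; omega)
  have hq' : (q.concat hk).IsPath :=
    SimpleGraph.Walk.isPath_of_length_eq_dist _ (by rw [SimpleGraph.Walk.length_concat]; omega)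
  have := (hG.existsUnique_path r j).unique hp' hq'
  rw [← SimpleGraph.Walk.penultimate_concat p hi, this, SimpleGraph.Walk.penultimate_concat]

theorem SimpleGraph.Walk.le_add_length {V : Type*} {G : SimpleGraph V} {f : V → ℕ}
    (hf : ∀ a b, G.Adj a b → f b ≤ f a + 1) {u v : V} (p : G.Walk u v) :
    f v ≤ f u + p.length := by
  induction p with
  | nil => simp
  | cons h p ih =>
    have := hf _ _ h
    rw [SimpleGraph.Walk.length_cons]
    omega

/-- `i` is the smallest neighbour of `j` which is closer to the root `0`. -/
def IsBfsParent {n : ℕ} (G : SimpleGraph (Fin (n + 1))) (i j : Fin (n + 1)) : Prop :=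
  (G.Adj i j ∧ G.dist 0 j = G.dist 0 i + 1) ∧
    ∀ k, G.Adj k j → G.dist 0 j = G.dist 0 k + 1 → i ≤ k

/-- The breadth-first spanning tree of `G` (Penrose's map from connected graphs to trees). -/
def bfsTree {n : ℕ} (G : SimpleGraph (Fin (n + 1))) : SimpleGraph (Fin (n + 1)) where
  Adj i j := IsBfsParent G i j ∨ IsBfsParent G j i
  symm := ⟨fun _ _ h => h.symm⟩
  loopless := ⟨fun i h => by
    have : G.Adj i i := h.elim (fun h => h.1.1) (fun h => h.1.1)
    exact G.loopless.irrefl i this⟩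

theorem IsBfsParent.unique {n : ℕ} {G : SimpleGraph (Fin (n + 1))} {i k j : Fin (n + 1)}
    (hi : IsBfsParent G i j) (hk : IsBfsParent G k j) : i = k :=
  le_antisymm (hi.2 k hk.1.1 hk.1.2) (hk.2 i hi.1.1 hi.1.2)

theorem exists_isBfsParent {n : ℕ} {G : SimpleGraph (Fin (n + 1))} (hG : G.Connected)
    {j : Fin (n + 1)} (hj : j ≠ 0) : ∃ i, IsBfsParent G i j := by
  obtain ⟨i, hi⟩ := hG.exists_adj_dist_succ hj
  obtain ⟨m, hm, hmin⟩ := WellFounded.has_min (wellFounded_lt (α := Fin (n + 1)))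
    {i | G.Adj i j ∧ G.dist 0 j = G.dist 0 i + 1} ⟨i, hi⟩
  exact ⟨m, hm, fun k hk hkd => not_lt.mp (hmin k ⟨hk, hkd⟩)⟩

theorem bfsTree_le {n : ℕ} (G : SimpleGraph (Fin (n + 1))) : bfsTree G ≤ G := by
  intro i j h
  exact h.elim (fun h => h.1.1) (fun h => h.1.1.symm)

theorem bfsTree_reachable {n : ℕ} {G : SimpleGraph (Fin (n + 1))} (hG : G.Connected)
    (v : Fin (n + 1)) : (bfsTree G).Reachable 0 v ∧ (bfsTree G).dist 0 v ≤ G.dist 0 v := by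
  induction hk : G.dist 0 v generalizing v with
  | zero =>
    obtain rfl : 0 = v := hG.dist_eq_zero_iff.mp hk
    simp
  | succ k ih =>
    have hv : v ≠ 0 := by rintro rfl; simp at hk
    obtain ⟨i, hi⟩ := exists_isBfsParent hG hv
    obtain ⟨hr, hd⟩ := ih i (by have := hi.1.2; omega)
    have hadj : (bfsTree G).Adj i v := Or.inl hi
    refine ⟨hr.trans hadj.reachable, ?_⟩
    obtain ⟨p, hp⟩ := hr.exists_walk_length_eq_dist
    have := SimpleGraph.dist_le (p.concat hadj)
    rw [SimpleGraph.Walk.length_concat] at this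
    omega

theorem bfsTree_dist {n : ℕ} {G : SimpleGraph (Fin (n + 1))} (hG : G.Connected)
    (v : Fin (n + 1)) : (bfsTree G).dist 0 v = G.dist 0 v :=
  le_antisymm (bfsTree_reachable hG v).2
    ((bfsTree_reachable hG v).1.dist_anti (bfsTree_le G))

theorem bfsTree_isTree {n : ℕ} {G : SimpleGraph (Fin (n + 1))} (hG : G.Connected) :
    (bfsTree G).IsTree := by
  have hconn : (bfsTree G).Connected :=
    SimpleGraph.connected_iff_exists_forall_reachable _ |>.mpr
      ⟨0, fun v => (bfsTree_reachable hG v).1⟩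
  rw [SimpleGraph.isTree_iff_connected_and_card]
  refine ⟨hconn, le_antisymm ?_ hconn.card_vert_le_card_edgeSet_add_one⟩
  have hex : ∀ j : {j : Fin (n + 1) // j ≠ 0}, ∃ i, IsBfsParent G i j :=
    fun j => exists_isBfsParent hG j.2
  choose p hp using hex
  let F : {j : Fin (n + 1) // j ≠ 0} → (bfsTree G).edgeSet :=
    fun j => ⟨s(p j, j), Or.inl (hp j)⟩
  have hF : Function.Surjective F := by
    have key : ∀ i j, IsBfsParent G i j → ∃ a, (F a : Sym2 _) = s(i, j) := by
      intro i j h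
      have hj : j ≠ 0 := by
        rintro rfl
        have := h.1.2
        simp at this
      exact ⟨⟨j, hj⟩, congrArg (fun a => s(a, j)) ((hp ⟨j, hj⟩).unique h)⟩
    rintro ⟨e, he⟩
    induction e using Sym2.ind with
    | _ i j =>
      rcases he with h | h
      · obtain ⟨a, ha⟩ := key i j h
        exact ⟨a, Subtype.ext ha⟩
      · obtain ⟨a, ha⟩ := key j i h
        exact ⟨a, Subtype.ext (ha.trans Sym2.eq_swap)⟩
  have := Nat.card_le_card_of_surjective F hF
  rw [Nat.card_eq_fintype_card (α := {j : Fin (n + 1) // j ≠ 0}), Fintype.card_subtype_compl, Fintype.card_subtype_eq,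
    Fintype.card_fin] at this
  rw [Nat.card_eq_fintype_card (α := Fin (n + 1)), Fintype.card_fin]
  omega

theorem mem_childrenF_bfsTree {n : ℕ} {G : SimpleGraph (Fin (n + 1))} (hG : G.Connected)
    (i j : Fin (n + 1)) : j ∈ childrenF (bfsTree G) i ↔ IsBfsParent G i j := by
  rw [mem_childrenF, bfsTree_dist hG, bfsTree_dist hG]
  constructor
  · rintro ⟨h | h, hd⟩
    · exact h
    · have := h.1.2
      omega
  · exact fun h => ⟨Or.inl h, h.1.2⟩

/-- The largest graph whose breadth-first tree is `τ`. -/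
def penroseMax {n : ℕ} (τ : SimpleGraph (Fin (n + 1))) : SimpleGraph (Fin (n + 1)) :=
  SimpleGraph.fromRel fun i j =>
    τ.dist 0 i = τ.dist 0 j ∨
      (τ.dist 0 j = τ.dist 0 i + 1 ∧ ∃ k, j ∈ childrenF τ k ∧ k ≤ i)

theorem SimpleGraph.IsTree.adj_iff_mem_childrenF {n : ℕ} {τ : SimpleGraph (Fin (n + 1))}
    (hτ : τ.IsTree) (i j : Fin (n + 1)) : τ.Adj i j ↔ j ∈ childrenF τ i ∨ i ∈ childrenF τ j := by
  rw [mem_childrenF, mem_childrenF]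
  constructor
  · intro h
    have := hτ.dist_eq_dist_add_one_of_adj 0 h
    tauto
  · rintro (h | h)
    · exact h.1
    · exact h.1.symm

theorem SimpleGraph.IsTree.eq_of_mem_childrenF {n : ℕ} {τ : SimpleGraph (Fin (n + 1))}
    (hτ : τ.IsTree) {i k j : Fin (n + 1)} (hi : j ∈ childrenF τ i) (hk : j ∈ childrenF τ k) :
    i = k := by
  rw [mem_childrenF] at hi hk
  exact hτ.eq_of_adj_of_dist_succ hi.1 hi.2 hk.1 hk.2

theorem SimpleGraph.IsTree.exists_mem_childrenF {n : ℕ} {τ : SimpleGraph (Fin (n + 1))}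
    (hτ : τ.IsTree) {j : Fin (n + 1)} (hj : j ≠ 0) : ∃ i, j ∈ childrenF τ i := by
  obtain ⟨i, hi⟩ := hτ.connected.exists_adj_dist_succ hj
  exact ⟨i, (mem_childrenF _ _ _).mpr hi⟩

theorem le_penroseMax {n : ℕ} {τ : SimpleGraph (Fin (n + 1))} (hτ : τ.IsTree) :
    τ ≤ penroseMax τ := by
  intro i j h
  refine ⟨h.ne, ?_⟩
  rcases (hτ.adj_iff_mem_childrenF i j).mp h with h | h
  · exact Or.inl (Or.inr ⟨((mem_childrenF _ _ _).mp h).2, i, h, le_rfl⟩)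
  · exact Or.inr (Or.inr ⟨((mem_childrenF _ _ _).mp h).2, j, h, le_rfl⟩)

theorem connected_and_bfsTree_eq_iff {n : ℕ} {τ : SimpleGraph (Fin (n + 1))} (hτ : τ.IsTree)
    (G : SimpleGraph (Fin (n + 1))) :
    (G.Connected ∧ bfsTree G = τ) ↔ (τ ≤ G ∧ G ≤ penroseMax τ) := by
  constructor
  · rintro ⟨hG, rfl⟩
    refine ⟨bfsTree_le G, ?_⟩
    have key : ∀ i j, G.Adj i j → G.dist 0 j = G.dist 0 i + 1 →
        ∃ k, j ∈ childrenF (bfsTree G) k ∧ k ≤ i := by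
      intro i j hij hd
      have hj : j ≠ 0 := by rintro rfl; simp at hd
      obtain ⟨k, hk⟩ := exists_isBfsParent hG hj
      exact ⟨k, (mem_childrenF_bfsTree hG k j).mpr hk, hk.2 i hij hd⟩
    intro i j hij
    refine ⟨hij.ne, ?_⟩
    simp only [bfsTree_dist hG]
    have h3 := SimpleGraph.Adj.diff_dist_adj (u := 0) hij
    rcases h3 with h | h | h
    · exact Or.inl (Or.inl h.symm)
    · exact Or.inl (Or.inr ⟨h, key i j hij h⟩)
    · by_cases h0 : G.dist 0 i = 0
      · exact Or.inl (Or.inl (by omega))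
      · have h' : G.dist 0 i = G.dist 0 j + 1 := by omega
        exact Or.inr (Or.inr ⟨h', key j i hij.symm h'⟩)
  · rintro ⟨h1, h2⟩
    have hG : G.Connected := hτ.connected.mono h1
    have hlip : ∀ a b, G.Adj a b → τ.dist 0 b ≤ τ.dist 0 a + 1 := by
      intro a b hab
      obtain ⟨-, h⟩ := h2 hab
      rcases h with (h | h) | (h | h) <;> omega
    have hdist : ∀ v, G.dist 0 v = τ.dist 0 v := by
      intro v
      refine le_antisymm ((hτ.connected 0 v).dist_anti h1) ?_
      obtain ⟨p, hp⟩ := hG.exists_walk_length_eq_dist 0 v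
      have := p.le_add_length hlip
      simp only [SimpleGraph.dist_self] at this
      omega
    have hpar : ∀ i j, j ∈ childrenF τ i → IsBfsParent G i j := by
      intro i j h
      have h' := (mem_childrenF _ _ _).mp h
      refine ⟨⟨h1 h'.1, by rw [hdist, hdist]; exact h'.2⟩, ?_⟩
      intro k hk hkd
      rw [hdist, hdist] at hkd
      obtain ⟨-, h3⟩ := h2 hk
      rcases h3 with (h3 | ⟨-, k', hk', hle⟩) | (h3 | ⟨h3, -⟩)
      · omega
      · rwa [hτ.eq_of_mem_childrenF h hk']
      · omega
      · omega
    have hpar' : ∀ i j, IsBfsParent G i j → j ∈ childrenF τ i := by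
      intro i j h
      have hj : j ≠ 0 := by
        rintro rfl
        have := h.1.2
        simp at this
      obtain ⟨k, hk⟩ := hτ.exists_mem_childrenF hj
      rwa [h.unique (hpar k j hk)]
    refine ⟨hG, ?_⟩
    ext i j
    rw [hτ.adj_iff_mem_childrenF]
    exact or_congr ⟨hpar' i j, hpar i j⟩ ⟨hpar' j i, hpar j i⟩

/-- The edges of a graph on `Fin m`, as ordered pairs. -/
def edgePairs {m : ℕ} (G : SimpleGraph (Fin m)) : Finset (Fin m × Fin m) :=
  Finset.univ.filter fun p => p.1 < p.2 ∧ G.Adj p.1 p.2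

theorem mem_edgePairs {m : ℕ} (G : SimpleGraph (Fin m)) (p : Fin m × Fin m) :
    p ∈ edgePairs G ↔ p.1 < p.2 ∧ G.Adj p.1 p.2 := by
  simp [edgePairs]

theorem edgePairs_subset_iff {m : ℕ} {G H : SimpleGraph (Fin m)} :
    edgePairs G ⊆ edgePairs H ↔ G ≤ H := by
  constructor
  · intro h i j hij
    rcases lt_or_gt_of_ne hij.ne with hlt | hlt
    · exact ((mem_edgePairs H (i, j)).mp (h ((mem_edgePairs G (i, j)).mpr ⟨hlt, hij⟩))).2
    · exact ((mem_edgePairs H (j, i)).mp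
        (h ((mem_edgePairs G (j, i)).mpr ⟨hlt, hij.symm⟩))).2.symm
  · intro h p hp
    rw [mem_edgePairs] at hp ⊢
    exact ⟨hp.1, h hp.2⟩

theorem edgePairs_injective {m : ℕ} : Function.Injective (edgePairs (m := m)) := fun _ _ h =>
  le_antisymm (edgePairs_subset_iff.mp h.subset) (edgePairs_subset_iff.mp h.superset)

theorem edgePairs_fromRel {m : ℕ} {S : Finset (Fin m × Fin m)} (hS : ∀ p ∈ S, p.1 < p.2) :
    edgePairs (SimpleGraph.fromRel fun i j => (i, j) ∈ S) = S := by
  ext ⟨i, j⟩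
  rw [mem_edgePairs, SimpleGraph.fromRel_adj]
  constructor
  · rintro ⟨hlt, -, h | h⟩
    · exact h
    · exact absurd (hS _ h) (not_lt.mpr hlt.le)
  · exact fun h => ⟨hS _ h, (hS _ h).ne, Or.inl h⟩

theorem sum_prod_edgePairs_of_le {m : ℕ} {τ R : SimpleGraph (Fin m)} (hτR : τ ≤ R)
    (f : Fin m × Fin m → ℝ) :
    ∑ G ∈ Finset.univ.filter (fun G => τ ≤ G ∧ G ≤ R), ∏ p ∈ edgePairs G, f p =
      (∏ p ∈ edgePairs τ, f p) * ∏ p ∈ edgePairs R \ edgePairs τ, (1 + f p) := by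
  rw [Finset.prod_one_add, Finset.mul_sum]
  have hlt : ∀ S ∈ (edgePairs R \ edgePairs τ).powerset, ∀ p ∈ edgePairs τ ∪ S, p.1 < p.2 := by
    intro S hS p hp
    rcases Finset.mem_union.mp hp with h | h
    · exact ((mem_edgePairs _ _).mp h).1
    · exact ((mem_edgePairs _ _).mp
        (Finset.mem_sdiff.mp (Finset.mem_powerset.mp hS h)).1).1
  refine Finset.sum_nbij' (fun G => edgePairs G \ edgePairs τ)
    (fun S => SimpleGraph.fromRel fun i j => (i, j) ∈ edgePairs τ ∪ S) ?_ ?_ ?_ ?_ ?_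
  · intro G hG
    simp only [Finset.mem_filter, Finset.mem_univ, true_and] at hG
    exact Finset.mem_powerset.mpr (Finset.sdiff_subset_sdiff (edgePairs_subset_iff.mpr hG.2)
      Finset.Subset.rfl)
  · intro S hS
    simp only [Finset.mem_filter, Finset.mem_univ, true_and]
    rw [← edgePairs_subset_iff, ← edgePairs_subset_iff, edgePairs_fromRel (hlt S hS)]
    exact ⟨Finset.subset_union_left, Finset.union_subset (edgePairs_subset_iff.mpr hτR)
      ((Finset.mem_powerset.mp hS).trans Finset.sdiff_subset)⟩
  · intro G hG
    simp only [Finset.mem_filter, Finset.mem_univ, true_and] at hG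
    apply edgePairs_injective
    have h := Finset.union_sdiff_of_subset (edgePairs_subset_iff.mpr hG.1)
    rw [edgePairs_fromRel] <;> rw [h]
    exact fun p hp => ((mem_edgePairs _ _).mp hp).1
  · intro S hS
    rw [edgePairs_fromRel (hlt S hS), Finset.union_sdiff_left]
    refine Finset.sdiff_eq_self_of_disjoint ?_
    exact (Finset.disjoint_sdiff.mono_right (Finset.mem_powerset.mp hS)).symm
  · intro G hG
    simp only [Finset.mem_filter, Finset.mem_univ, true_and] at hG
    rw [mul_comm, Finset.prod_sdiff (edgePairs_subset_iff.mpr hG.1)]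

theorem SimpleGraph.IsTree.prod_childrenF {n : ℕ} {τ : SimpleGraph (Fin (n + 1))}
    (hτ : τ.IsTree) (f : Fin (n + 1) → Fin (n + 1) → ℝ) (hf : ∀ i j, f i j = f j i) :
    ∏ i, ∏ j ∈ childrenF τ i, f i j = ∏ p ∈ edgePairs τ, f p.1 p.2 := by
  rw [Finset.prod_sigma']
  have hnot : ∀ i j, j ∈ childrenF τ i → i ∉ childrenF τ j := by
    intro i j h h'
    rw [mem_childrenF] at h h'
    omega
  refine Finset.prod_nbij'
    (fun q => if q.1 < q.2 then (q.1, q.2) else (q.2, q.1))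
    (fun p => if p.2 ∈ childrenF τ p.1 then ⟨p.1, p.2⟩ else ⟨p.2, p.1⟩) ?_ ?_ ?_ ?_ ?_
  · rintro ⟨i, j⟩ h
    simp only [Finset.mem_sigma, Finset.mem_univ, true_and] at h
    have hadj := (hτ.adj_iff_mem_childrenF i j).mpr (Or.inl h)
    dsimp only
    split_ifs with hlt
    · exact (mem_edgePairs _ _).mpr ⟨hlt, hadj⟩
    · exact (mem_edgePairs _ _).mpr ⟨lt_of_le_of_ne (not_lt.mp hlt) hadj.ne', hadj.symm⟩
  · rintro ⟨i, j⟩ h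
    have h' := (hτ.adj_iff_mem_childrenF i j).mp ((mem_edgePairs _ _).mp h).2
    dsimp only
    split_ifs with hc
    · simpa using hc
    · simpa using h'.resolve_left hc
  · rintro ⟨i, j⟩ h
    simp only [Finset.mem_sigma, Finset.mem_univ, true_and] at h
    have := hnot i j h
    by_cases hlt : i < j <;> simp [hlt, h, this]
  · rintro ⟨i, j⟩ h
    have h1 : i < j := ((mem_edgePairs _ _).mp h).1
    by_cases hc : j ∈ childrenF τ i
    · simp [hc, h1]
    · simp [hc, h1.not_gt]
  · rintro ⟨i, j⟩ h
    dsimp only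
    split_ifs
    · rfl
    · exact hf i j

theorem prod_le_prod_of_subset_of_mem_unitInterval {ι : Type*} {s t : Finset ι} (hst : s ⊆ t)
    {f : ι → ℝ} (h0 : ∀ i ∈ t, 0 ≤ f i) (h1 : ∀ i ∈ t, f i ≤ 1) :
    ∏ i ∈ t, f i ≤ ∏ i ∈ s, f i := by
  rw [← Finset.prod_sdiff hst]
  refine mul_le_of_le_one_left (Finset.prod_nonneg fun i hi => h0 i (hst hi)) ?_
  exact Finset.prod_le_one (fun i hi => h0 i (Finset.sdiff_subset hi))
    (fun i hi => h1 i (Finset.sdiff_subset hi))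

/-- Pairs of siblings with parent `i`. -/
def siblingPairs {n : ℕ} (τ : SimpleGraph (Fin (n + 1))) (i : Fin (n + 1)) :
    Finset (Fin (n + 1) × Fin (n + 1)) :=
  (childrenF τ i ×ˢ childrenF τ i).filter fun p => p.1 < p.2

theorem mem_siblingPairs {n : ℕ} (τ : SimpleGraph (Fin (n + 1))) (i : Fin (n + 1))
    (p : Fin (n + 1) × Fin (n + 1)) : p ∈ siblingPairs τ i ↔
      (p.1 ∈ childrenF τ i ∧ p.2 ∈ childrenF τ i) ∧ p.1 < p.2 := by
  simp [siblingPairs]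

theorem abs_sum_penrose_le {S : Type*} {w : S → S → ℝ} (hsymm : ∀ a b, w a b = w b a)
    (h0 : ∀ a b, 0 ≤ w a b) (h1 : ∀ a b, w a b ≤ 1) {n : ℕ} {τ : SimpleGraph (Fin (n + 1))}
    (hτ : τ.IsTree) (x : Fin (n + 1) → S) :
    |∑ G ∈ Finset.univ.filter (fun G => τ ≤ G ∧ G ≤ penroseMax τ),
        ∏ p ∈ edgePairs G, (w (x p.1) (x p.2) - 1)| ≤
      ∏ i : Fin (n + 1), phiFinset w (x i) (childrenF τ i) x := by
  rw [sum_prod_edgePairs_of_le (le_penroseMax hτ), abs_mul, Finset.abs_prod]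
  simp only [phiFinset, Finset.prod_mul_distrib]
  rw [hτ.prod_childrenF (fun i j => 1 - w (x i) (x j)) (fun i j => by rw [hsymm])]
  have habs : ∀ p : Fin (n + 1) × Fin (n + 1),
      |w (x p.1) (x p.2) - 1| = 1 - w (x p.1) (x p.2) := fun p => by
    rw [abs_sub_comm, abs_of_nonneg (sub_nonneg.mpr (h1 _ _))]
  simp only [habs, add_sub_cancel]
  refine mul_le_mul_of_nonneg_left ?_
    (Finset.prod_nonneg fun p _ => sub_nonneg.mpr (h1 _ _))
  rw [abs_of_nonneg (Finset.prod_nonneg fun p _ => h0 _ _)]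
  change _ ≤ ∏ i, ∏ p ∈ siblingPairs τ i, w (x p.1) (x p.2)
  rw [← Finset.prod_biUnion]
  · refine prod_le_prod_of_subset_of_mem_unitInterval ?_ (fun _ _ => h0 _ _) (fun _ _ => h1 _ _)
    intro p hp
    simp only [Finset.mem_biUnion, Finset.mem_univ, true_and, mem_siblingPairs,
      mem_childrenF] at hp
    obtain ⟨i, ⟨hp1, hp2⟩, hlt⟩ := hp
    rw [Finset.mem_sdiff, mem_edgePairs, mem_edgePairs]
    refine ⟨⟨hlt, hlt.ne, Or.inl (Or.inl (by omega))⟩, fun h => ?_⟩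
    exact hτ.dist_ne_of_adj 0 h.2 (by omega)
  · intro i _ k _ hik
    rw [Function.onFun, Finset.disjoint_left]
    intro p hp hp'
    rw [mem_siblingPairs] at hp hp'
    exact hik (hτ.eq_of_mem_childrenF hp.1.1 hp'.1.1)

/-- Penrose's tree-graph inequality, keeping the sibling interactions. -/
theorem abs_omegaT_le_treeB {S : Type*} {w : S → S → ℝ} (hsymm : ∀ a b, w a b = w b a)
    (h0 : ∀ a b, 0 ≤ w a b) (h1 : ∀ a b, w a b ≤ 1) {n : ℕ} (x : Fin (n + 1) → S) :
    |omegaT w (n + 1) x| ≤ treeB w n x := by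
  have hmaps : ∀ G ∈ Finset.univ.filter (fun G : SimpleGraph (Fin (n + 1)) => G.Connected),
      bfsTree G ∈ Finset.univ.filter (fun τ : SimpleGraph (Fin (n + 1)) => τ.IsTree) := by
    intro G hG
    simp only [Finset.mem_filter, Finset.mem_univ, true_and] at hG ⊢
    exact bfsTree_isTree hG
  unfold omegaT treeB
  rw [← Finset.sum_filter, ← Finset.sum_filter, ← Finset.sum_fiberwise_of_maps_to hmaps]
  refine (Finset.abs_sum_le_sum_abs _ _).trans (Finset.sum_le_sum fun τ hτ => ?_)
  replace hτ : τ.IsTree := by simpa using hτ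
  refine le_trans (le_of_eq ?_) (abs_sum_penrose_le hsymm h0 h1 hτ x)
  rw [Finset.filter_filter]
  simp only [connected_and_bfsTree_eq_iff hτ]
  rfl

section PairWeight

variable {d : ℕ} (β : ℝ) (φ : (Fin d → ℝ) → ℝ≥0∞)

theorem pairW_nonneg (a b : Fin d → ℝ) : 0 ≤ pairW β φ a b := by
  unfold pairW
  split_ifs
  · exact le_rfl
  · exact (Real.exp_pos _).le

variable {β} in
theorem pairW_le_one (hβ : 0 < β) (a b : Fin d → ℝ) : pairW β φ a b ≤ 1 := by
  unfold pairW
  split_ifs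
  · exact zero_le_one
  · exact Real.exp_le_one_iff.mpr (neg_nonpos.mpr (mul_nonneg hβ.le ENNReal.toReal_nonneg))

variable {φ} in
theorem pairW_symm (hφ : ∀ v, φ (-v) = φ v) (a b : Fin d → ℝ) :
    pairW β φ a b = pairW β φ b a := by
  unfold pairW
  rw [← hφ (a - b), neg_sub]

theorem pairW_sub_sub (a b c : Fin d → ℝ) : pairW β φ (a - c) (b - c) = pairW β φ a b := by
  unfold pairW
  rw [sub_sub_sub_cancel_right]

variable {φ} in
theorem measurable_pairW (hφ : Measurable φ) :
    Measurable fun p : (Fin d → ℝ) × (Fin d → ℝ) => pairW β φ p.1 p.2 := by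
  have h : Measurable fun p : (Fin d → ℝ) × (Fin d → ℝ) => φ (p.1 - p.2) :=
    hφ.comp (measurable_fst.sub measurable_snd)
  unfold pairW
  exact Measurable.ite (h (measurableSet_singleton ∞)) measurable_const
    (Real.measurable_exp.comp ((measurable_const.mul h.ennreal_toReal).neg))

variable {φ} in
theorem measurable_phiFinset (hφ : Measurable φ) {n : ℕ} (i : Fin n) (t : Finset (Fin n)) :
    Measurable fun x : Fin n → Fin d → ℝ => phiFinset (pairW β φ) (x i) t x := by
  have h : ∀ i j : Fin n, Measurable fun x : Fin n → Fin d → ℝ => pairW β φ (x i) (x j) :=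
    fun i j => (measurable_pairW β hφ).comp (f := fun x : Fin n → Fin d → ℝ => (x i, x j))
      ((measurable_pi_apply i).prodMk (measurable_pi_apply j))
  unfold phiFinset
  exact (Finset.measurable_prod _ fun j _ => measurable_const.sub (h i j)).mul
    (Finset.measurable_prod _ fun p _ => h p.1 p.2)

theorem phiFinset_nonneg {S : Type*} {w : S → S → ℝ} (h0 : ∀ a b, 0 ≤ w a b)
    (h1 : ∀ a b, w a b ≤ 1) {n : ℕ} (a : S) (t : Finset (Fin n)) (x : Fin n → S) :
    0 ≤ phiFinset w a t x :=
  mul_nonneg (Finset.prod_nonneg fun _ _ => sub_nonneg.mpr (h1 _ _))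
    (Finset.prod_nonneg fun _ _ => h0 _ _)

theorem phiFinset_congr {S : Type*} {w : S → S → ℝ} {n : ℕ} (a : S) {t : Finset (Fin n)}
    {x y : Fin n → S} (h : ∀ j ∈ t, x j = y j) : phiFinset w a t x = phiFinset w a t y := by
  unfold phiFinset
  congr 1
  · exact Finset.prod_congr rfl fun j hj => by rw [h j hj]
  · refine Finset.prod_congr rfl fun p hp => ?_
    simp only [Finset.mem_filter, Finset.mem_product] at hp
    rw [h _ hp.1.1, h _ hp.1.2]

theorem phiFinset_eq_phiVertex {S : Type*} (w : S → S → ℝ) {n : ℕ} (a : S) (t : Finset (Fin n))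
    (x : Fin n → S) :
    phiFinset w a t x = phiVertex w t.card a fun k => x (t.orderIsoOfFin rfl k) := by
  unfold phiFinset phiVertex
  congr 1
  · rw [← Finset.prod_coe_sort]
    exact (Fintype.prod_equiv (t.orderIsoOfFin rfl).toEquiv _ _ fun _ => rfl).symm
  · symm
    refine Finset.prod_bij
      (fun p _ => ((t.orderIsoOfFin rfl p.1 : Fin n), (t.orderIsoOfFin rfl p.2 : Fin n))) ?_ ?_ ?_ ?_
    · intro p hp
      simpa using hp
    · intro p _ q _ h
      simpa [Prod.ext_iff] using h
    · rintro ⟨i, j⟩ h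
      simp only [Finset.mem_filter, Finset.mem_product] at h
      refine ⟨((t.orderIsoOfFin rfl).symm ⟨i, h.1.1⟩, (t.orderIsoOfFin rfl).symm ⟨j, h.1.2⟩), ?_, ?_⟩
      · simpa using h.2
      · simp only [OrderIso.apply_symm_apply]
    · intro p _
      rfl

theorem phiVertex_pairW_sub (n : ℕ) (a : Fin d → ℝ) (y : Fin n → Fin d → ℝ) :
    phiVertex (pairW β φ) n a y = phiVertex (pairW β φ) n 0 (y - fun _ => a) := by
  unfold phiVertex
  simp only [Pi.sub_apply, pairW_sub_sub]
  rw [← sub_self a]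
  simp only [pairW_sub_sub]

theorem lintegral_phiVertex (n : ℕ) (a : Fin d → ℝ) :
    ∫⁻ y : Fin n → Fin d → ℝ, ENNReal.ofReal (phiVertex (pairW β φ) n a y) = gCoef β φ n := by
  simp_rw [phiVertex_pairW_sub β φ n a]
  exact lintegral_sub_right_eq_self
    (fun y : Fin n → Fin d → ℝ => ENNReal.ofReal (phiVertex (pairW β φ) n 0 y)) _

theorem gCoef_zero : gCoef β φ 0 = 1 := by
  simp [gCoef, phiVertex, volume_pi]

end PairWeight

section Marginal

variable {δ X : Type*} [DecidableEq δ] [MeasureSpace X]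

theorem lmarginal_eq_lintegral_of_equiv [SigmaFinite (volume : Measure X)] {ι : Type*} [Fintype ι] {t : Finset δ} (e : ι ≃ t)
    (f : (δ → X) → ℝ≥0∞) (x : δ → X) :
    (∫⋯∫⁻_t, f ∂fun _ => volume) x =
      ∫⁻ y : ι → X, f (Function.updateFinset x t fun j => y (e.symm j)) := by
  unfold lmarginal
  refine (MeasurePreserving.lintegral_map_equiv (fun y => f (Function.updateFinset x t y)) _
    (measurePreserving_piCongrLeft (fun _ : t => (volume : Measure X)) e)).trans
    (lintegral_congr fun y => ?_)
  congr 2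
  ext j : 1
  obtain ⟨k, rfl⟩ := e.surjective j
  rw [MeasurableEquiv.coe_piCongrLeft, Equiv.piCongrLeft_apply_apply, Equiv.symm_apply_apply]

theorem lmarginal_mul_left {t : Finset δ} {f g : (δ → X) → ℝ≥0∞} (hg : Measurable g) (x : δ → X)
    (hf : ∀ y : t → X, f (Function.updateFinset x t y) = f x) :
    (∫⋯∫⁻_t, f * g ∂fun _ => volume) x = f x * (∫⋯∫⁻_t, g ∂fun _ => volume) x := by
  unfold lmarginal
  simp only [Pi.mul_apply, hf]
  exact lintegral_const_mul _ (hg.comp measurable_updateFinset)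

end Marginal

section TreeIntegral

variable {d : ℕ} (β : ℝ) (φ : (Fin d → ℝ) → ℝ≥0∞)

theorem lmarginal_phiFinset {n : ℕ} {i : Fin n} {t : Finset (Fin n)} (hi : i ∉ t)
    (x : Fin n → Fin d → ℝ) :
    (∫⋯∫⁻_t, fun x => ENNReal.ofReal (phiFinset (pairW β φ) (x i) t x) ∂fun _ => volume) x =
      gCoef β φ t.card := by
  rw [lmarginal_eq_lintegral_of_equiv (t.orderIsoOfFin rfl).toEquiv,
    ← lintegral_phiVertex β φ t.card (x i)]
  refine lintegral_congr fun y => ?_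
  rw [phiFinset_eq_phiVertex]
  have h : ∀ k, Function.updateFinset x t
      (fun j => y ((t.orderIsoOfFin rfl).toEquiv.symm j)) (t.orderIsoOfFin rfl k) = y k := by
    intro k
    rw [Function.updateFinset, dif_pos (Subtype.prop _)]
    exact congrArg y ((t.orderIsoOfFin rfl).symm_apply_apply k)
  simp only [h]
  simp [Function.updateFinset, hi]

variable {φ} in
theorem lmarginal_prod_phiFinset (hφ : Measurable φ) {n : ℕ} {τ : SimpleGraph (Fin (n + 1))}
    (hτ : τ.IsTree) (s : Finset (Fin (n + 1))) (x : Fin (n + 1) → Fin d → ℝ) :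
    (∫⋯∫⁻_s.biUnion (childrenF τ), fun x => ∏ i ∈ s,
        ENNReal.ofReal (phiFinset (pairW β φ) (x i) (childrenF τ i) x) ∂fun _ => volume) x =
      ∏ i ∈ s, gCoef β φ (childrenF τ i).card := by
  have hmeas : ∀ i, Measurable fun x : Fin (n + 1) → Fin d → ℝ =>
      ENNReal.ofReal (phiFinset (pairW β φ) (x i) (childrenF τ i) x) :=
    fun i => (measurable_phiFinset β hφ i _).ennreal_ofReal
  induction s using Finset.induction_on_min_value (fun i => τ.dist 0 i) generalizing x with
  | empty => simp
  | insert a s ha hmin ih =>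
    have hdisj : Disjoint (childrenF τ a) (s.biUnion (childrenF τ)) := by
      rw [Finset.disjoint_left]
      intro j hj hj'
      obtain ⟨k, hk, hjk⟩ := Finset.mem_biUnion.mp hj'
      exact ha (hτ.eq_of_mem_childrenF hj hjk ▸ hk)
    have hself : a ∉ s.biUnion (childrenF τ) := by
      intro h
      obtain ⟨k, hk, hak⟩ := Finset.mem_biUnion.mp h
      have := hmin k hk
      have := ((mem_childrenF _ _ _).mp hak).2
      omega
    have hself' : a ∉ childrenF τ a := by simp [mem_childrenF]
    rw [Finset.biUnion_insert, Finset.prod_insert ha, lmarginal_union _ _ _ hdisj]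
    · have hinner : (∫⋯∫⁻_s.biUnion (childrenF τ), (fun x => ∏ i ∈ insert a s,
            ENNReal.ofReal (phiFinset (pairW β φ) (x i) (childrenF τ i) x)) ∂fun _ => volume) =
          (fun _ => ∏ i ∈ s, gCoef β φ (childrenF τ i).card) *
            fun x => ENNReal.ofReal (phiFinset (pairW β φ) (x a) (childrenF τ a) x) := by
        ext x
        rw [Pi.mul_apply, ← ih x, mul_comm]
        simp only [Finset.prod_insert ha]
        refine lmarginal_mul_left (f := fun x =>
          ENNReal.ofReal (phiFinset (pairW β φ) (x a) (childrenF τ a) x))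
          (Finset.measurable_prod _ fun i _ => hmeas i) x fun y => ?_
        congr 1
        simp only [Function.updateFinset, hself, dif_neg, not_false_eq_true]
        refine phiFinset_congr _ fun j hj => ?_
        exact dif_neg (Finset.disjoint_left.mp hdisj hj)
      rw [hinner, lmarginal_mul_left (hmeas a) x fun y => rfl, lmarginal_phiFinset β φ hself',
        mul_comm]
    · exact Finset.measurable_prod _ fun i _ => hmeas i

/-- The sum over trees on `{0,…,n}` of the products of vertex integrals. -/
def treeWeight (g : ℕ → ℝ≥0∞) (n : ℕ) : ℝ≥0∞ :=
  ∑ τ : SimpleGraph (Fin (n + 1)) with τ.IsTree, ∏ i, g (childrenF τ i).card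

theorem SimpleGraph.IsTree.biUnion_childrenF {n : ℕ} {τ : SimpleGraph (Fin (n + 1))}
    (hτ : τ.IsTree) : Finset.univ.biUnion (childrenF τ) = Finset.univ.erase 0 := by
  ext j
  simp only [Finset.mem_biUnion, Finset.mem_univ, true_and, Finset.mem_erase, and_true]
  refine ⟨?_, hτ.exists_mem_childrenF⟩
  rintro ⟨i, hi⟩ rfl
  have := ((mem_childrenF _ _ _).mp hi).2
  simp at this

theorem ofReal_treeB {S : Type*} {w : S → S → ℝ} (h0 : ∀ a b, 0 ≤ w a b)
    (h1 : ∀ a b, w a b ≤ 1) (n : ℕ) (x : Fin (n + 1) → S) :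
    ENNReal.ofReal (treeB w n x) = ∑ τ : SimpleGraph (Fin (n + 1)) with τ.IsTree,
      ∏ i, ENNReal.ofReal (phiFinset w (x i) (childrenF τ i) x) := by
  unfold treeB
  rw [← Finset.sum_filter, ENNReal.ofReal_sum_of_nonneg]
  · exact Finset.sum_congr rfl fun τ _ =>
      ENNReal.ofReal_prod_of_nonneg fun i _ => phiFinset_nonneg h0 h1 _ _ _
  · exact fun τ _ => Finset.prod_nonneg fun i _ => phiFinset_nonneg h0 h1 _ _ _

variable {β φ}

theorem measurable_ofReal_treeB (hβ : 0 < β) (hφ : Measurable φ) (n : ℕ) :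
    Measurable fun x : Fin (n + 1) → Fin d → ℝ => ENNReal.ofReal (treeB (pairW β φ) n x) := by
  simp only [ofReal_treeB (pairW_nonneg β φ) (pairW_le_one φ hβ)]
  exact Finset.measurable_sum _ fun τ _ => Finset.measurable_prod _ fun i _ =>
    (measurable_phiFinset β hφ i _).ennreal_ofReal

theorem lmarginal_treeB (hβ : 0 < β) (hφ : Measurable φ) (n : ℕ)
    (x : Fin (n + 1) → Fin d → ℝ) :
    (∫⋯∫⁻_Finset.univ.erase 0, fun x => ENNReal.ofReal (treeB (pairW β φ) n x)
      ∂fun _ => volume) x = treeWeight (gCoef β φ) n := by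
  simp only [ofReal_treeB (pairW_nonneg β φ) (pairW_le_one φ hβ)]
  unfold treeWeight lmarginal
  rw [lintegral_finsetSum]
  · refine Finset.sum_congr rfl fun τ hτ => ?_
    replace hτ : τ.IsTree := by simpa using hτ
    rw [← lmarginal_prod_phiFinset β hφ hτ Finset.univ x, hτ.biUnion_childrenF]
    rfl
  · exact fun τ _ => (Finset.measurable_prod _ fun i _ =>
      (measurable_phiFinset β hφ i _).ennreal_ofReal).comp measurable_updateFinset

theorem lintegral_treeB_cons (hβ : 0 < β) (hφ : Measurable φ) (n : ℕ) :
    ∫⁻ y : Fin n → Fin d → ℝ, ENNReal.ofReal (treeB (pairW β φ) n (Fin.cons 0 y)) =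
      treeWeight (gCoef β φ) n := by
  let e : Fin n ≃ (Finset.univ.erase 0 : Finset (Fin (n + 1))) :=
    Equiv.ofBijective (fun j => ⟨j.succ, by simp⟩)
      ⟨fun i j h => by simpa using h, fun ⟨j, hj⟩ => by
        obtain ⟨k, rfl⟩ := Fin.exists_succ_eq.mpr (Finset.ne_of_mem_erase hj)
        exact ⟨k, rfl⟩⟩
  rw [← lmarginal_treeB hβ hφ n fun _ => 0, lmarginal_eq_lintegral_of_equiv e]
  refine lintegral_congr fun y => ?_
  congr 2
  ext j : 1
  refine Fin.cases ?_ (fun k => ?_) j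
  · simp [Function.updateFinset]
  · have : e k = ⟨k.succ, by simp⟩ := rfl
    simp [Function.updateFinset, ← this]

theorem setLIntegral_treeB_le (hβ : 0 < β) (hφ : Measurable φ) (n : ℕ)
    {Λ : Set (Fin d → ℝ)} (hΛ : MeasurableSet Λ) :
    ∫⁻ x in Set.univ.pi (fun _ : Fin (n + 1) => Λ), ENNReal.ofReal (treeB (pairW β φ) n x) ≤
      volume Λ * treeWeight (gCoef β φ) n := by
  have hmeas := measurable_ofReal_treeB (d := d) hβ hφ n
  have hind : Measurable fun x : Fin (n + 1) → Fin d → ℝ => Λ.indicator (1 : (Fin d → ℝ) → ℝ≥0∞) (x 0) :=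
    (measurable_one.indicator hΛ).comp (measurable_pi_apply 0)
  have hunion : (Finset.univ : Finset (Fin (n + 1))) = {0} ∪ Finset.univ.erase 0 := by
    ext j
    simp
  have hinner : (∫⋯∫⁻_Finset.univ.erase 0,
      (fun x : Fin (n + 1) → Fin d → ℝ => Λ.indicator (1 : (Fin d → ℝ) → ℝ≥0∞) (x 0)) *
        (fun x => ENNReal.ofReal (treeB (pairW β φ) n x)) ∂fun _ => volume) =
      fun x => Λ.indicator (1 : (Fin d → ℝ) → ℝ≥0∞) (x 0) * treeWeight (gCoef β φ) n := by
    ext x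
    rw [lmarginal_mul_left hmeas x fun y => by simp [Function.updateFinset],
      lmarginal_treeB hβ hφ]
  calc ∫⁻ x in Set.univ.pi (fun _ : Fin (n + 1) => Λ), ENNReal.ofReal (treeB (pairW β φ) n x)
      = ∫⁻ x, (Set.univ.pi fun _ : Fin (n + 1) => Λ).indicator
          (fun x => ENNReal.ofReal (treeB (pairW β φ) n x)) x :=
        (lintegral_indicator (MeasurableSet.univ_pi fun _ => hΛ) _).symm
    _ ≤ ∫⁻ x, ((fun x : Fin (n + 1) → Fin d → ℝ => Λ.indicator (1 : (Fin d → ℝ) → ℝ≥0∞) (x 0)) *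
          fun x => ENNReal.ofReal (treeB (pairW β φ) n x)) x := by
        refine lintegral_mono fun x => Set.indicator_le' (fun x hx => ?_) (fun _ _ => zero_le) x
        simp [hx 0 (Set.mem_univ 0)]
    _ = volume Λ * treeWeight (gCoef β φ) n := by
        rw [volume_pi, lintegral_eq_lmarginal_univ (fun _ => 0), hunion,
          lmarginal_union _ _ (hind.mul hmeas) (by simp), hinner, lmarginal_singleton]
        simp only [Function.update_self]
        rw [lintegral_mul_const _ (measurable_one.indicator hΛ), lintegral_indicator_one hΛ]

end TreeIntegral

theorem ENNReal.sum_le_sum_of_injOn {ι κ : Type*} [DecidableEq κ] {s : Finset ι} {t : Finset κ}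
    {f : ι → ℝ≥0∞} {g : κ → ℝ≥0∞} (e : ι → κ) (hst : ∀ a ∈ s, e a ∈ t)
    (he : Set.InjOn e s) (hfg : ∀ a ∈ s, f a ≤ g (e a)) : ∑ a ∈ s, f a ≤ ∑ b ∈ t, g b :=
  calc ∑ a ∈ s, f a ≤ ∑ a ∈ s, g (e a) := Finset.sum_le_sum hfg
    _ = ∑ b ∈ s.image e, g b := (Finset.sum_image he).symm
    _ ≤ ∑ b ∈ t, g b := Finset.sum_le_sum_of_subset (Finset.image_subset_iff.mpr hst)

section Forest

variable {α : Type*} [DecidableEq α]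

/-- `ch` is the children map of a forest with root set `A` and set of non-root vertices `V`. -/
structure IsForest (A V : Finset α) (ch : α → Finset α) : Prop where
  eq_empty : ∀ i, i ∉ A → i ∉ V → ch i = ∅
  eq_of_mem : ∀ i j k, k ∈ ch i → k ∈ ch j → i = j
  mem_iff : ∀ k, k ∈ V ↔ ∃ i, k ∈ ch i
  acyclic : ∃ r : α → ℕ, ∀ i, ∀ k ∈ ch i, r i < r k

theorem IsForest.nonempty_roots {A V : Finset α} {ch : α → Finset α} (h : IsForest A V ch)
    (hV : V.Nonempty) : A.Nonempty := by
  obtain ⟨r, hr⟩ := h.acyclic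
  obtain ⟨v, hv, hmin⟩ := Finset.exists_min_image V r hV
  obtain ⟨i, hi⟩ := (h.mem_iff v).mp hv
  by_contra hA
  rw [Finset.not_nonempty_iff_eq_empty] at hA
  by_cases hiV : i ∈ V
  · exact absurd (hr i v hi) (not_lt.mpr (hmin i hiV))
  · rw [h.eq_empty i (by simp [hA]) hiV] at hi
    simp at hi

theorem IsForest.update {A V : Finset α} {ch : α → Finset α} (h : IsForest A V ch)
    (a : α) :
    IsForest (A.erase a ∪ ch a) (V \ ch a) (Function.update ch a ∅) := by
  have hsub : ∀ i, Function.update ch a ∅ i ⊆ ch i := by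
    intro i
    by_cases hi : i = a
    · subst hi; simp
    · simp [hi]
  refine ⟨?_, ?_, ?_, ?_⟩
  · intro i hA hV
    by_cases hi : i = a
    · subst hi; simp
    · simp only [Finset.mem_union, Finset.mem_erase, Finset.mem_sdiff, not_or, not_and] at hA hV
      rw [Function.update_of_ne hi]
      exact h.eq_empty i (hA.1 hi) fun hiV => (hV hiV) hA.2
  · exact fun i j k hi hj => h.eq_of_mem i j k (hsub i hi) (hsub j hj)
  · intro k
    rw [Finset.mem_sdiff, h.mem_iff]
    constructor
    · rintro ⟨⟨i, hi⟩, hk⟩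
      have : i ≠ a := by rintro rfl; exact hk hi
      exact ⟨i, by rwa [Function.update_of_ne this]⟩
    · rintro ⟨i, hi⟩
      refine ⟨⟨i, hsub i hi⟩, fun hk => ?_⟩
      obtain rfl := h.eq_of_mem _ _ _ hk (hsub i hi)
      simp at hi
  · obtain ⟨r, hr⟩ := h.acyclic
    exact ⟨r, fun i k hk => hr i k (hsub i hk)⟩

variable [Fintype α]

/-- Total weight of the forests with root set `A` and set of non-root vertices `V`. -/
def forestWeight (g : ℕ → ℝ≥0∞) (A V : Finset α) : ℝ≥0∞ :=
  ∑ ch : α → Finset α with IsForest A V ch, ∏ i ∈ A ∪ V, g (ch i).card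

/-- Total weight of the forests with `m` roots and `n` further vertices, computed by exploring
the vertices one at a time; the first argument is the total number of vertices `m + n`. -/
def exploreWeight (g : ℕ → ℝ≥0∞) : ℕ → ℕ → ℕ → ℝ≥0∞
  | 0, _, _ => 1
  | _ + 1, 0, _ => 0
  | k + 1, m + 1, n => ∑ c ∈ Finset.range (n + 1),
      n.choose c • (g c * exploreWeight g k (m + c) (n - c))

theorem forestWeight_le_sum (g : ℕ → ℝ≥0∞) {A V : Finset α} (hAV : Disjoint A V) {a : α}
    (ha : a ∈ A) :
    forestWeight g A V ≤
      ∑ C ∈ V.powerset, g C.card * forestWeight g (A.erase a ∪ C) (V \ C) := by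
  have hmaps : ∀ ch ∈ Finset.univ.filter (fun ch : α → Finset α => IsForest A V ch),
      ch a ∈ V.powerset := by
    intro ch hch
    replace hch : IsForest A V ch := by simpa using hch
    exact Finset.mem_powerset.mpr fun k hk => (hch.mem_iff k).mpr ⟨a, hk⟩
  unfold forestWeight
  rw [← Finset.sum_fiberwise_of_maps_to hmaps]
  refine Finset.sum_le_sum fun C hC => ?_
  rw [Finset.mem_powerset] at hC
  rw [Finset.mul_sum]
  have haV : a ∉ V := Finset.disjoint_left.mp hAV ha
  refine ENNReal.sum_le_sum_of_injOn (fun ch => Function.update ch a ∅) ?_ ?_ ?_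
  · intro ch hch
    simp only [Finset.mem_filter, Finset.mem_univ, true_and] at hch ⊢
    obtain ⟨hch, rfl⟩ := hch
    exact hch.update a
  · intro ch hch ch' hch' heq
    simp only [Finset.coe_filter, Finset.mem_filter, Finset.mem_univ, true_and,
      Set.mem_ofPred_eq] at hch hch'
    ext1 i
    by_cases hi : i = a
    · rw [hi, hch.2, hch'.2]
    · simpa [hi] using congrFun heq i
  · intro ch hch
    simp only [Finset.mem_filter, Finset.mem_univ, true_and] at hch
    have hunion : A.erase a ∪ C ∪ V \ C = (A ∪ V).erase a := by
      rw [Finset.union_assoc, Finset.union_sdiff_of_subset hC, Finset.erase_union_distrib,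
        Finset.erase_eq_of_notMem haV]
    rw [hunion, ← Finset.mul_prod_erase _ _ (Finset.mem_union_left V ha), hch.2]
    refine le_of_eq (congrArg _ (Finset.prod_congr rfl fun i hi => ?_))
    rw [Function.update_of_ne (Finset.ne_of_mem_erase hi)]

theorem forestWeight_le_exploreWeight (g : ℕ → ℝ≥0∞) (k : ℕ) {A V : Finset α}
    (hAV : Disjoint A V) (hk : A.card + V.card = k) :
    forestWeight g A V ≤ exploreWeight g k A.card V.card := by
  induction k generalizing A V with
  | zero =>
    obtain rfl : A = ∅ := Finset.card_eq_zero.mp (by omega)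
    obtain rfl : V = ∅ := Finset.card_eq_zero.mp (by omega)
    have : Finset.univ.filter (fun ch : α → Finset α => IsForest ∅ ∅ ch) ⊆ {fun _ => ∅} := by
      intro ch hch
      replace hch : IsForest ∅ ∅ ch := by simpa using hch
      rw [Finset.mem_singleton]
      ext1 i
      exact hch.eq_empty i (by simp) (by simp)
    refine (Finset.sum_le_sum_of_subset this).trans ?_
    simp [exploreWeight]
  | succ k ih =>
    rcases A.eq_empty_or_nonempty with rfl | ⟨a, ha⟩
    · have hV : V.Nonempty := Finset.card_pos.mp (by rw [Finset.card_empty] at hk; omega)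
      have : Finset.univ.filter (fun ch : α → Finset α => IsForest ∅ V ch) = ∅ := by
        rw [Finset.filter_eq_empty_iff]
        intro ch _ hch
        simpa using hch.nonempty_roots hV
      simp [forestWeight, this]
    · obtain ⟨m, hm⟩ : ∃ m, A.card = m + 1 := Nat.exists_eq_add_one.mpr (Finset.card_pos.mpr ⟨a, ha⟩)
      refine (forestWeight_le_sum g hAV ha).trans ?_
      rw [hm, exploreWeight, ← Finset.sum_powerset_apply_card
        (fun c => g c * exploreWeight g k (m + c) (V.card - c))]
      refine Finset.sum_le_sum fun C hC => ?_
      rw [Finset.mem_powerset] at hC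
      have h1 : (A.erase a ∪ C).card = m + C.card := by
        rw [Finset.card_union_of_disjoint, Finset.card_erase_of_mem ha, hm, Nat.add_sub_cancel]
        exact (hAV.mono_right hC).mono_left (Finset.erase_subset _ _)
      have h2 : (V \ C).card = V.card - C.card := Finset.card_sdiff_of_subset hC
      have h3 := Finset.card_le_card hC
      rw [← h1, ← h2]
      refine mul_le_mul_right (ih ?_ (by omega)) _
      rw [Finset.disjoint_union_left]
      exact ⟨hAV.mono (Finset.erase_subset _ _) Finset.sdiff_subset, Finset.disjoint_sdiff⟩

end Forest

theorem SimpleGraph.IsTree.isForest {n : ℕ} {τ : SimpleGraph (Fin (n + 1))} (hτ : τ.IsTree) :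
    IsForest {0} (Finset.univ.erase 0) (childrenF τ) where
  eq_empty i h0 h := absurd (by simpa using h) (by simpa using h0)
  eq_of_mem _ _ _ hi hj := hτ.eq_of_mem_childrenF hi hj
  mem_iff k := by rw [← hτ.biUnion_childrenF]; simp
  acyclic := ⟨τ.dist 0, fun i k hk => by have := ((mem_childrenF _ _ _).mp hk).2; omega⟩

theorem treeWeight_le_exploreWeight (g : ℕ → ℝ≥0∞) (n : ℕ) :
    treeWeight g n ≤ exploreWeight g (1 + n) 1 n := by
  have h : treeWeight g n ≤ forestWeight g {(0 : Fin (n + 1))} (Finset.univ.erase 0) := by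
    refine ENNReal.sum_le_sum_of_injOn childrenF ?_ ?_ ?_
    · intro τ hτ
      simp only [Finset.mem_filter, Finset.mem_univ, true_and] at hτ ⊢
      exact hτ.isForest
    · intro τ hτ σ hσ heq
      simp only [Finset.coe_filter, Finset.mem_univ, true_and, Set.mem_ofPred_eq] at hτ hσ
      ext i j
      rw [hτ.adj_iff_mem_childrenF, hσ.adj_iff_mem_childrenF, heq]
    · intro τ _
      refine le_of_eq (Finset.prod_congr ?_ fun _ _ => rfl)
      ext i
      simp
  refine h.trans ?_
  have := forestWeight_le_exploreWeight g (1 + n) (A := {(0 : Fin (n + 1))})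
    (V := Finset.univ.erase 0) (by simp) (by simp)
  simpa using this

theorem ENNReal.choose_mul_inv_factorial {n c : ℕ} (h : c ≤ n) :
    (n.choose c : ℝ≥0∞) * (n.factorial : ℝ≥0∞)⁻¹ =
      (c.factorial : ℝ≥0∞)⁻¹ * ((n - c).factorial : ℝ≥0∞)⁻¹ := by
  have hc : ∀ k : ℕ, ((k.factorial : ℕ) : ℝ≥0∞) ≠ 0 :=
    fun k => Nat.cast_ne_zero.mpr (Nat.factorial_ne_zero k)
  have hch : (n.choose c : ℝ≥0∞) ≠ 0 := Nat.cast_ne_zero.mpr (Nat.choose_pos h).ne'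
  rw [← Nat.choose_mul_factorial_mul_factorial h]
  push_cast
  rw [mul_assoc, ENNReal.mul_inv (Or.inl hch) (Or.inl (ENNReal.natCast_ne_top _)), ← mul_assoc,
    ENNReal.mul_inv_cancel hch (ENNReal.natCast_ne_top _), one_mul,
    ENNReal.mul_inv (Or.inl (hc _)) (Or.inl (ENNReal.natCast_ne_top _))]

/-- If `K` dominates the vertex generating function at `r * K`, then `K ^ m` dominates the
generating function of forests with `m` roots. -/
theorem sum_exploreWeight_le {g : ℕ → ℝ≥0∞} {r K : ℝ≥0∞}
    (hK : ∑' c, g c * (r * K) ^ c * (c.factorial : ℝ≥0∞)⁻¹ ≤ K) (N m : ℕ) :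
    ∑ n ∈ Finset.range N, r ^ n * (n.factorial : ℝ≥0∞)⁻¹ * exploreWeight g (m + n) m n ≤
      K ^ m := by
  induction hs : m + N using Nat.strong_induction_on generalizing m N with
  | _ s ih =>
  cases m with
  | zero =>
    calc ∑ n ∈ Finset.range N, r ^ n * (n.factorial : ℝ≥0∞)⁻¹ * exploreWeight g (0 + n) 0 n
        ≤ ∑ n ∈ {0}, r ^ n * (n.factorial : ℝ≥0∞)⁻¹ * exploreWeight g (0 + n) 0 n := by
          refine Finset.sum_le_sum_of_ne_zero fun n _ hn => ?_
          cases n with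
          | zero => simp
          | succ n => exact absurd (by rw [zero_add, exploreWeight, mul_zero]) hn
      _ ≤ K ^ 0 := by simp [exploreWeight]
  | succ m =>
    let F : ℕ → ℕ → ℝ≥0∞ := fun c l => g c * r ^ c * (c.factorial : ℝ≥0∞)⁻¹ *
      (r ^ l * (l.factorial : ℝ≥0∞)⁻¹ * exploreWeight g (m + c + l) (m + c) l)
    have hterm : ∀ n, r ^ n * (n.factorial : ℝ≥0∞)⁻¹ * exploreWeight g (m + 1 + n) (m + 1) n =
        ∑ c ∈ Finset.range (n + 1), F c (n - c) := by
      intro n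
      rw [show m + 1 + n = m + n + 1 by ring, exploreWeight, Finset.mul_sum]
      refine Finset.sum_congr rfl fun c hc => ?_
      have hcn : c ≤ n := Nat.lt_succ_iff.mp (Finset.mem_range.mp hc)
      simp only [F]
      rw [show m + c + (n - c) = m + n by omega, nsmul_eq_mul]
      calc r ^ n * (n.factorial : ℝ≥0∞)⁻¹ *
            ((n.choose c : ℝ≥0∞) * (g c * exploreWeight g (m + n) (m + c) (n - c)))
          = r ^ n * ((n.choose c : ℝ≥0∞) * (n.factorial : ℝ≥0∞)⁻¹) *
            (g c * exploreWeight g (m + n) (m + c) (n - c)) := by ring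
        _ = _ := by
          rw [ENNReal.choose_mul_inv_factorial hcn]
          nth_rewrite 1 [show n = c + (n - c) by omega]
          rw [pow_add]
          ring
    simp only [hterm]
    rw [Finset.sum_range_diag_flip]
    calc ∑ c ∈ Finset.range N, ∑ l ∈ Finset.range (N - c), F c l
        ≤ ∑ c ∈ Finset.range N, K ^ m * (g c * (r * K) ^ c * (c.factorial : ℝ≥0∞)⁻¹) := by
          refine Finset.sum_le_sum fun c hc => ?_
          rw [Finset.mem_range] at hc
          have := ih (m + c + (N - c)) (by omega) (N - c) (m + c) rfl
          simp only [F]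
          rw [← Finset.mul_sum]
          refine (mul_le_mul_right this _).trans (le_of_eq ?_)
          rw [mul_pow, pow_add]
          ring
      _ ≤ K ^ m * K := by
          rw [← Finset.mul_sum]
          exact mul_le_mul_right ((ENNReal.sum_le_tsum _).trans hK) _
      _ = K ^ (m + 1) := (pow_succ K m).symm

theorem tsum_treeWeight_le {g : ℕ → ℝ≥0∞} {r K : ℝ≥0∞}
    (hK : ∑' c, g c * (r * K) ^ c * (c.factorial : ℝ≥0∞)⁻¹ ≤ K) :
    ∑' n, r ^ n * (n.factorial : ℝ≥0∞)⁻¹ * treeWeight g n ≤ K := by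
  rw [ENNReal.tsum_eq_iSup_nat]
  refine iSup_le fun N => ?_
  refine (Finset.sum_le_sum fun n _ => mul_le_mul_right (treeWeight_le_exploreWeight g n) _).trans ?_
  simpa using sum_exploreWeight_le hK N 1

theorem treeWeight_zero {g : ℕ → ℝ≥0∞} (hg : g 0 = 1) : treeWeight g 0 = 1 := by
  have : Subsingleton (Fin (0 + 1)) := inferInstanceAs (Subsingleton (Fin 1))
  have h : ∀ τ : SimpleGraph (Fin (0 + 1)), τ.IsTree := fun τ =>
    SimpleGraph.IsTree.of_subsingleton
  have hc : ∀ (τ : SimpleGraph (Fin (0 + 1))) i, childrenF τ i = ∅ := by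
    intro τ i
    rw [Finset.eq_empty_iff_forall_notMem]
    intro j hj
    exact ((mem_childrenF _ _ _).mp hj).1.ne (Subsingleton.elim i j)
  simp [treeWeight, h, hc, hg]

section Main

variable {d : ℕ} {β : ℝ} {φ : (Fin d → ℝ) → ℝ≥0∞}

theorem vertexSum_eq_tsum (t : ℝ≥0∞) :
    vertexSum β φ t = ∑' n, gCoef β φ n * t ^ n * (n.factorial : ℝ≥0∞)⁻¹ := by
  rw [tsum_eq_zero_add' ENNReal.summable]
  simp [vertexSum, gCoef_zero, div_eq_mul_inv]

theorem ENNReal.ofReal_pow_div_factorial {r : ℝ} (hr : 0 ≤ r) (n : ℕ) :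
    ENNReal.ofReal (r ^ n / n.factorial) =
      ENNReal.ofReal r ^ n * (n.factorial : ℝ≥0∞)⁻¹ := by
  rw [ENNReal.ofReal_div_of_pos (by positivity), ENNReal.ofReal_pow hr, ENNReal.ofReal_natCast,
    div_eq_mul_inv]

theorem treeSum_eq_tsum (hβ : 0 < β) (hφ : Measurable φ) {r : ℝ} (hr : 0 ≤ r) :
    treeSum β φ r = ∑' n, ENNReal.ofReal r ^ n * (n.factorial : ℝ≥0∞)⁻¹ *
      treeWeight (gCoef β φ) n := by
  rw [tsum_eq_zero_add' ENNReal.summable]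
  simp [treeSum, lintegral_treeB_cons hβ hφ, ENNReal.ofReal_pow_div_factorial hr,
    treeWeight_zero (gCoef_zero β φ)]

theorem ofReal_mul_treeSum_le (hβ : 0 < β) (hφ : Measurable φ) {r : ℝ} (hr : 0 ≤ r) {M : ℝ≥0∞}
    (hM : M ≠ ∞) (h : ENNReal.ofReal r ≤ M / vertexSum β φ M) :
    ENNReal.ofReal r * treeSum β φ r ≤ M := by
  rw [treeSum_eq_tsum hβ hφ hr]
  by_cases hr0 : ENNReal.ofReal r = 0
  · simp [hr0]
  have hΨ : vertexSum β φ M ≠ 0 := by simp [vertexSum]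
  have hK : vertexSum β φ M ≤ M / ENNReal.ofReal r := by
    rw [ENNReal.le_div_iff_mul_le (Or.inl hΨ) (Or.inr hM)] at h
    rwa [ENNReal.le_div_iff_mul_le (Or.inl hr0) (Or.inl ENNReal.ofReal_ne_top), mul_comm]
  have hrK : ENNReal.ofReal r * (M / ENNReal.ofReal r) = M :=
    ENNReal.mul_div_cancel hr0 ENNReal.ofReal_ne_top
  have := tsum_treeWeight_le (g := gCoef β φ) (r := ENNReal.ofReal r)
    (K := M / ENNReal.ofReal r) (by rwa [hrK, ← vertexSum_eq_tsum])
  exact (mul_le_mul_right this _).trans hrK.le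

theorem enorm_cluster_term_le (hβ : 0 < β) (hφm : Measurable φ) (hφ : ∀ v, φ (-v) = φ v)
    (z : ℂ) {Λ : Set (Fin d → ℝ)} (hΛ : MeasurableSet Λ) (n : ℕ) :
    ‖z ^ (n + 1) / ((n + 1).factorial : ℂ) *
        ((∫ x in Set.univ.pi (fun _ : Fin (n + 1) => Λ),
          omegaT (pairW β φ) (n + 1) x : ℝ) : ℂ)‖ₑ ≤
      volume Λ * (ENNReal.ofReal ‖z‖ * (ENNReal.ofReal ‖z‖ ^ n * (n.factorial : ℝ≥0∞)⁻¹ *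
        treeWeight (gCoef β φ) n)) := by
  have hint : ‖((∫ x in Set.univ.pi (fun _ : Fin (n + 1) => Λ),
      omegaT (pairW β φ) (n + 1) x : ℝ) : ℂ)‖ₑ ≤ volume Λ * treeWeight (gCoef β φ) n := by
    rw [← ofReal_norm, Complex.norm_real, ofReal_norm]
    refine (enorm_integral_le_lintegral_enorm _).trans
      ((lintegral_mono fun x => ?_).trans (setLIntegral_treeB_le hβ hφm n hΛ))
    rw [← ofReal_norm, Real.norm_eq_abs]
    exact ENNReal.ofReal_le_ofReal (abs_omegaT_le_treeB (pairW_symm β hφ) (pairW_nonneg β φ)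
      (pairW_le_one φ hβ) x)
  have hcoef : ‖z ^ (n + 1) / ((n + 1).factorial : ℂ)‖ₑ ≤
      ENNReal.ofReal ‖z‖ * (ENNReal.ofReal ‖z‖ ^ n * (n.factorial : ℝ≥0∞)⁻¹) := by
    rw [← ofReal_norm, norm_div, norm_pow, Complex.norm_natCast,
      ENNReal.ofReal_pow_div_factorial (norm_nonneg z), ← mul_assoc, ← pow_succ']
    refine mul_le_mul_right (ENNReal.inv_le_inv.mpr ?_) _
    exact_mod_cast Nat.factorial_le (Nat.le_succ n)
  rw [enorm_mul]
  exact (mul_le_mul' hcoef hint).trans (le_of_eq (by ring))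

end Main

theorem statement3 {d : ℕ} (hd : 1 ≤ d) (β : ℝ) (hβ : 0 < β)
    (φ : (Fin d → ℝ) → ℝ≥0∞) (hφm : Measurable φ) (hφeven : ∀ v, φ (-v) = φ v)
    (hT : ∫⁻ v : Fin d → ℝ, ENNReal.ofReal (1 - pairW β φ v 0) < ∞)
    (z : ℂ) (μ : ℝ) (hμ : 0 < μ)
    (hz : ENNReal.ofReal ‖z‖ ≤ ENNReal.ofReal μ / vertexSum β φ (ENNReal.ofReal μ)) :
    ENNReal.ofReal ‖z‖ * treeSum β φ ‖z‖ ≤ ENNReal.ofReal μ ∧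
    ∀ Λ : Set (Fin d → ℝ), MeasurableSet Λ → volume Λ < ∞ →
      Summable (fun n : ℕ => z ^ (n + 1) / ((n + 1).factorial : ℂ) *
          ((∫ x in Set.univ.pi (fun _ : Fin (n + 1) => Λ),
            omegaT (pairW β φ) (n + 1) x : ℝ) : ℂ)) ∧
      ENNReal.ofReal ‖∑' n : ℕ, z ^ (n + 1) / ((n + 1).factorial : ℂ) *
          ((∫ x in Set.univ.pi (fun _ : Fin (n + 1) => Λ),
            omegaT (pairW β φ) (n + 1) x : ℝ) : ℂ)‖
        ≤ volume Λ * (ENNReal.ofReal ‖z‖ * treeSum β φ ‖z‖) ∧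
      volume Λ * (ENNReal.ofReal ‖z‖ * treeSum β φ ‖z‖) ≤ volume Λ * ENNReal.ofReal μ := by
  have hTree := ofReal_mul_treeSum_le hβ hφm (norm_nonneg z) ENNReal.ofReal_ne_top hz
  refine ⟨hTree, fun Λ hΛ hΛfin => ?_⟩
  have hbound : ∑' n : ℕ, ‖z ^ (n + 1) / ((n + 1).factorial : ℂ) *
      ((∫ x in Set.univ.pi (fun _ : Fin (n + 1) => Λ),
        omegaT (pairW β φ) (n + 1) x : ℝ) : ℂ)‖ₑ ≤
      volume Λ * (ENNReal.ofReal ‖z‖ * treeSum β φ ‖z‖) := by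
    rw [treeSum_eq_tsum hβ hφm (norm_nonneg z), ← ENNReal.tsum_mul_left, ← ENNReal.tsum_mul_left]
    exact ENNReal.tsum_le_tsum fun n => enorm_cluster_term_le hβ hφm hφeven z hΛ n
  have hlast := mul_le_mul_right hTree (volume Λ)
  refine ⟨Summable.of_enorm (ne_top_of_le_ne_top ?_ (hbound.trans hlast)), ?_, hlast⟩
  · exact ENNReal.mul_ne_top hΛfin.ne ENNReal.ofReal_ne_top
  · rw [ofReal_norm]
    exact enorm_tsum_le_tsum_enorm.trans hbound
end
end

section
/- Let n ≥ 2, let A be a commutative ring, and let f(i,j) ∈ A be given for each pair 1 ≤ i < j ≤ n (extended symmetrically). Let R : 𝒯[n] → 𝒞[n] be any partition scheme, i.e., E(τ) ⊆ E(R(τ)) for every tree τ, and the graph intervals [τ, R(τ)] := {G ∈ 𝒞[n] : E(τ) ⊆ E(G) ⊆ E(R(τ))}, τ ∈ 𝒯[n], are pairwise disjoint with union 𝒞[n]. Then Σ_{G ∈ 𝒞[n]} Π_{{i,j}∈E(G)} f(i,j) = Σ_{τ ∈ 𝒯[n]} ( Π_{{i,j}∈E(τ)} f(i,j) ) · ( Π_{{i,j}∈E(R(τ))∖E(τ)}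 (1 + f(i,j)) ). -/
open scoped Classical

/-- The edges of a graph, each listed once as an increasing pair of vertices. -/
noncomputable def SimpleGraph.increasingPairs {V : Type*} [Fintype V] [LinearOrder V]
    (G : SimpleGraph V) : Finset (V × V) :=
  Finset.univ.filter fun p : V × V => p.1 < p.2 ∧ G.Adj p.1 p.2

theorem SimpleGraph.mem_increasingPairs {V : Type*} [Fintype V] [LinearOrder V]
    {G : SimpleGraph V} {p : V × V} :
    p ∈ G.increasingPairs ↔ p.1 < p.2 ∧ G.Adj p.1 p.2 := by
  simp [SimpleGraph.increasingPairs]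

theorem SimpleGraph.increasingPairs_subset_iff {V : Type*} [Fintype V] [LinearOrder V]
    {G H : SimpleGraph V} : G.increasingPairs ⊆ H.increasingPairs ↔ G ≤ H := by
  constructor
  · intro h a b hab
    rcases lt_or_gt_of_ne hab.ne with hlt | hlt
    · exact (mem_increasingPairs.1 (h (mem_increasingPairs (p := (a, b)).2 ⟨hlt, hab⟩))).2
    · exact (mem_increasingPairs.1
        (h (mem_increasingPairs (p := (b, a)).2 ⟨hlt, hab.symm⟩))).2.symm
  · intro h p hp
    rw [mem_increasingPairs] at hp ⊢
    exact ⟨hp.1, h hp.2⟩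

theorem SimpleGraph.increasingPairs_injective {V : Type*} [Fintype V] [LinearOrder V] :
    Function.Injective (SimpleGraph.increasingPairs (V := V)) := fun _ _ h =>
  le_antisymm (increasingPairs_subset_iff.1 h.subset) (increasingPairs_subset_iff.1 h.superset)

theorem SimpleGraph.exists_increasingPairs_eq {V : Type*} [Fintype V] [LinearOrder V]
    (t : Finset (V × V)) (ht : ∀ p ∈ t, p.1 < p.2) :
    ∃ G : SimpleGraph V, G.increasingPairs = t := by
  refine ⟨SimpleGraph.fromRel fun a b => (a, b) ∈ t, ?_⟩
  ext ⟨a, b⟩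
  rw [mem_increasingPairs, SimpleGraph.fromRel_adj]
  constructor
  · rintro ⟨hlt, -, h | h⟩
    · exact h
    · exact absurd (ht _ h) hlt.asymm
  · intro h
    exact ⟨ht _ h, (ht _ h).ne, Or.inl h⟩

/-- The edge-weighted sum over a graph interval factorizes. -/
theorem SimpleGraph.sum_interval_prod_increasingPairs {V A : Type*} [Fintype V] [LinearOrder V]
    [CommRing A] (w : V × V → A) {H K : SimpleGraph V} (hHK : H ≤ K) :
    ∑ G : SimpleGraph V with H ≤ G ∧ G ≤ K, ∏ p ∈ G.increasingPairs, w p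
      = (∏ p ∈ H.increasingPairs, w p) *
        ∏ p ∈ K.increasingPairs \ H.increasingPairs, (1 + w p) := by
  rw [Finset.prod_one_add, Finset.mul_sum]
  refine Finset.sum_bij (fun G _ => G.increasingPairs \ H.increasingPairs) ?_ ?_ ?_ ?_
  · intro G hG
    rw [Finset.mem_filter] at hG
    exact Finset.mem_powerset.2
      (Finset.sdiff_subset_sdiff (increasingPairs_subset_iff.2 hG.2.2) le_rfl)
  · intro G₁ h₁ G₂ h₂ h
    rw [Finset.mem_filter] at h₁ h₂
    apply increasingPairs_injective
    rw [← Finset.sdiff_union_of_subset (increasingPairs_subset_iff.2 h₁.2.1), h,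
      Finset.sdiff_union_of_subset (increasingPairs_subset_iff.2 h₂.2.1)]
  · intro t ht
    rw [Finset.mem_powerset, Finset.subset_sdiff] at ht
    have hsub : H.increasingPairs ∪ t ⊆ K.increasingPairs :=
      Finset.union_subset (increasingPairs_subset_iff.2 hHK) ht.1
    obtain ⟨G, hG⟩ := exists_increasingPairs_eq (H.increasingPairs ∪ t)
      fun p hp => (mem_increasingPairs.1 (hsub hp)).1
    refine ⟨G, ?_, ?_⟩
    · rw [Finset.mem_filter, ← increasingPairs_subset_iff, ← increasingPairs_subset_iff, hG]
      exact ⟨Finset.mem_univ _, Finset.subset_union_left, hsub⟩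
    · rw [hG, Finset.union_sdiff_cancel_left ht.2.symm]
  · intro G hG
    rw [Finset.mem_filter] at hG
    rw [mul_comm, Finset.prod_sdiff (increasingPairs_subset_iff.2 hG.2.1)]

/-- rewriting of the sum over connected graphs via a partition scheme. -/
theorem statement10 {A : Type*} [CommRing A] (n : ℕ) (hn : 2 ≤ n)
    (f : Fin n → Fin n → A)
    (R : SimpleGraph (Fin n) → SimpleGraph (Fin n))
    (hR1 : ∀ τ : SimpleGraph (Fin n), τ.IsTree → τ ≤ R τ)
    (hR2 : ∀ G : SimpleGraph (Fin n), G.Connected →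
      ∃! τ : SimpleGraph (Fin n), τ.IsTree ∧ τ ≤ G ∧ G ≤ R τ) :
    (∑ G : SimpleGraph (Fin n),
      if G.Connected then
        ∏ p ∈ Finset.univ.filter (fun p : Fin n × Fin n => p.1 < p.2 ∧ G.Adj p.1 p.2),
          f p.1 p.2
      else 0)
    = ∑ τ : SimpleGraph (Fin n),
        if τ.IsTree then
          (∏ p ∈ Finset.univ.filter (fun p : Fin n × Fin n => p.1 < p.2 ∧ τ.Adj p.1 p.2),
            f p.1 p.2) *
          ∏ p ∈ Finset.univ.filter
              (fun p : Fin n × Fin n => p.1 < p.2 ∧ (R τ).Adj p.1 p.2 ∧ ¬ τ.Adj p.1 p.2),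
            (1 + f p.1 p.2)
        else 0 := by
  have hconn : ∀ G : SimpleGraph (Fin n),
      (if G.Connected then ∏ p ∈ G.increasingPairs, f p.1 p.2 else 0)
        = ∑ τ : SimpleGraph (Fin n), if τ.IsTree ∧ τ ≤ G ∧ G ≤ R τ then
            ∏ p ∈ G.increasingPairs, f p.1 p.2 else 0 := by
    intro G
    split_ifs with hG
    · obtain ⟨τ, hτ, huniq⟩ := hR2 G hG
      rw [Finset.sum_eq_single τ (fun σ _ hσ => if_neg fun h => hσ (huniq σ h))
        (fun h => absurd (Finset.mem_univ τ) h), if_pos hτ]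
    · exact (Finset.sum_eq_zero fun τ _ =>
        if_neg fun h => hG (h.1.connected.mono h.2.1)).symm
  refine (Finset.sum_congr rfl fun G _ => hconn G).trans ?_
  rw [Finset.sum_comm]
  refine Finset.sum_congr rfl fun τ _ => ?_
  split_ifs with hτ
  · have hdiff : Finset.univ.filter (fun p : Fin n × Fin n =>
        p.1 < p.2 ∧ (R τ).Adj p.1 p.2 ∧ ¬ τ.Adj p.1 p.2)
          = (R τ).increasingPairs \ τ.increasingPairs := by
      ext p
      simp only [Finset.mem_filter, Finset.mem_univ, true_and, Finset.mem_sdiff,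
        SimpleGraph.mem_increasingPairs]
      tauto
    rw [hdiff]
    simp only [hτ, true_and]
    rw [← Finset.sum_filter]
    convert SimpleGraph.sum_interval_prod_increasingPairs (fun p => f p.1 p.2) (hR1 τ hτ) using 2
    refine Finset.prod_congr ?_ fun _ _ => rfl
    ext p
    simp [SimpleGraph.mem_increasingPairs]
  · exact Finset.sum_eq_zero fun G _ => if_neg fun h => hτ h.1
end
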